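/- arXiv:2011.12947 — 4 statements merged into one kernel-verified Lean document; each statement's English description precedes it below -/
import Mathlib

section
/- Let Δ > 1 be a real number and let G₁, G₂ be real numbers with 1/Δ < |G₁| < Δ and 1/Δ < |G₂| < Δ. Let P̄ ≥ 1, λ > 0, ν ≥ 0 be real numbers and let T, U be natural numbers with T < P̄^(λ+ν) and U < P̄^(λ+ν). Define V = ⌊G₁·T⌋ + ⌊G₂·U⌋, Z = ⌊G₁·⌊T/P̄^ν⌋⌋ + ⌊G₂·⌊U/P̄^ν⌋⌋, q = ⌊V/P̄^(λ+ν)⌋, and W = ⌊(V − P̄^(λ+ν)·q)/P̄^ν⌋ (the top-λ sub-section of V). Then |q| ≤ 2Δ + 3, and there exists an integer e with |e| ≤ 4Δ + 6 such that W = Z + ⌊−P̄^λ·q⌋ + e. In particular, the top-λ sub-section of the floor-linear combination ⌊G₁T⌋ + ⌊G₂U⌋ differs from the floor-linear combination of the top sub-sections ⌊T/P̄^ν⌋, ⌊U/P̄^ν⌋ only by correction terms determined by two integers ranging over sets whose size is bounded by a constant depending only on Δ. -/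
/-- A coefficient of absolute value at most `Δ` scales `x ∈ [0, c]` into `[-Δ c, Δ c]`. -/
theorem abs_mul_le_of_mem_Icc {G Δ x c : ℝ} (hG : |G| ≤ Δ) (hx : 0 ≤ x) (hxc : x ≤ c) :
    |G * x| ≤ Δ * c := by
  rw [abs_mul, abs_of_nonneg hx]
  exact mul_le_mul hG hxc hx ((abs_nonneg G).trans hG)

/-- deterministic core of the sub-section / linear-combination lemma
(Lemma `const` of the paper, Appendix C). -/
theorem subsection_of_combination (Δ G₁ G₂ Pb lam ν : ℝ) (hΔ : 1 < Δ)
    (hG1l : 1 / Δ < |G₁|) (hG1u : |G₁| < Δ) (hG2l : 1 / Δ < |G₂|) (hG2u : |G₂| < Δ)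
    (hP : 1 ≤ Pb) (hlam : 0 < lam) (hν : 0 ≤ ν)
    (T U : ℕ) (hT : (T : ℝ) < Pb ^ (lam + ν)) (hU : (U : ℝ) < Pb ^ (lam + ν))
    (V Z q W : ℤ)
    (hV : V = ⌊G₁ * (T : ℝ)⌋ + ⌊G₂ * (U : ℝ)⌋)
    (hZ : Z = ⌊G₁ * ((⌊(T : ℝ) / Pb ^ ν⌋ : ℤ) : ℝ)⌋ + ⌊G₂ * ((⌊(U : ℝ) / Pb ^ ν⌋ : ℤ) : ℝ)⌋)
    (hq : q = ⌊(V : ℝ) / Pb ^ (lam + ν)⌋)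
    (hW : W = ⌊((V : ℝ) - Pb ^ (lam + ν) * (q : ℝ)) / Pb ^ ν⌋) :
    |(q : ℝ)| ≤ 2 * Δ + 3 ∧
      ∃ e : ℤ, |(e : ℝ)| ≤ 4 * Δ + 6 ∧ W = Z + ⌊-(Pb ^ lam) * (q : ℝ)⌋ + e := by
  have ha : 1 ≤ Pb ^ ν := Real.one_le_rpow hP hν
  have hb : 1 ≤ Pb ^ lam := Real.one_le_rpow hP hlam.le
  rw [Real.rpow_add (by linarith)] at hT hU hq hW
  generalize Pb ^ ν = a at *
  generalize Pb ^ lam = b at *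
  have ha0 : 0 < a := by linarith
  have hab : 1 ≤ b * a := one_le_mul_of_one_le_of_one_le hb ha
  have hab0 : 0 < b * a := by linarith
  have hVR : (V : ℝ) = ⌊G₁ * (T : ℝ)⌋ + ⌊G₂ * (U : ℝ)⌋ := by rw [hV]; push_cast; rfl
  have hVl : G₁ * T + G₂ * U - 2 < V := by
    linarith [Int.sub_one_lt_floor (G₁ * (T : ℝ)), Int.sub_one_lt_floor (G₂ * (U : ℝ))]
  have hVu : (V : ℝ) ≤ G₁ * T + G₂ * U := by
    linarith [Int.floor_le (G₁ * (T : ℝ)), Int.floor_le (G₂ * (U : ℝ))]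
  constructor
  · have hGT := abs_le.1 (abs_mul_le_of_mem_Icc hG1u.le T.cast_nonneg hT.le)
    have hGU := abs_le.1 (abs_mul_le_of_mem_Icc hG2u.le U.cast_nonneg hU.le)
    have hl : -(2 * Δ + 2) ≤ (V : ℝ) / (b * a) := by
      rw [le_div_iff₀ hab0]; linarith
    have hu : (V : ℝ) / (b * a) ≤ 2 * Δ := by
      rw [div_le_iff₀ hab0]; linarith
    have hql := Int.sub_one_lt_floor ((V : ℝ) / (b * a))
    have hqu := Int.floor_le ((V : ℝ) / (b * a))
    rw [← hq] at hql hqu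
    exact abs_le.2 ⟨by linarith, by linarith⟩
  · refine ⟨W - Z - ⌊-b * (q : ℝ)⌋, ?_, by ring⟩
    have hVa : ((V : ℝ) - b * a * q) / a = V / a - b * q := by field_simp
    rw [hVa] at hW
    have hWl := Int.sub_one_lt_floor ((V : ℝ) / a - b * q)
    have hWu := Int.floor_le ((V : ℝ) / a - b * q)
    rw [← hW] at hWl hWu
    have hVal : G₁ * (T / a) + G₂ * (U / a) - 2 ≤ V / a := by
      rw [le_div_iff₀ ha0]
      have : (G₁ * (T / a) + G₂ * (U / a) - 2) * a = G₁ * T + G₂ * U - 2 * a := by field_simp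
      linarith
    have hVau : V / a ≤ G₁ * (T / a) + G₂ * (U / a) := by
      rw [div_le_iff₀ ha0]
      have : (G₁ * (T / a) + G₂ * (U / a)) * a = G₁ * T + G₂ * U := by field_simp
      linarith
    have hfT := abs_le.1 (abs_mul_le_of_mem_Icc hG1u.le (Int.fract_nonneg ((T : ℝ) / a))
      (Int.fract_lt_one _).le)
    have hfU := abs_le.1 (abs_mul_le_of_mem_Icc hG2u.le (Int.fract_nonneg ((U : ℝ) / a))
      (Int.fract_lt_one _).le)
    rw [← Int.self_sub_floor, mul_sub] at hfT hfU
    have hZR : (Z : ℝ) = ⌊G₁ * ((⌊(T : ℝ) / a⌋ : ℤ) : ℝ)⌋ + ⌊G₂ * ((⌊(U : ℝ) / a⌋ : ℤ) : ℝ)⌋ := by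
      rw [hZ]; push_cast; rfl
    have hZ₁l := Int.sub_one_lt_floor (G₁ * ((⌊(T : ℝ) / a⌋ : ℤ) : ℝ))
    have hZ₁u := Int.floor_le (G₁ * ((⌊(T : ℝ) / a⌋ : ℤ) : ℝ))
    have hZ₂l := Int.sub_one_lt_floor (G₂ * ((⌊(U : ℝ) / a⌋ : ℤ) : ℝ))
    have hZ₂u := Int.floor_le (G₂ * ((⌊(U : ℝ) / a⌋ : ℤ) : ℝ))
    have hbl := Int.sub_one_lt_floor (-b * (q : ℝ))
    have hbu := Int.floor_le (-b * (q : ℝ))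
    push_cast
    exact abs_le.2 ⟨by linarith, by linarith⟩
end

section
/- Let α, β be real numbers with 1 < β < α, and let w₁, w₂ ≥ 0. Then sup{w₁·d₁ + w₂·d₂ : (d₁,d₂) ∈ D_p1(α,β)} ≤ 2 · sup{w₁·d₁ + w₂·d₂ : (d₁,d₂) ∈ D_fp1(α,β)}; that is, the maximal weighted sum GDoF achievable under finite precision CSIT is at least half the maximal weighted sum GDoF achievable under perfect CSIT in Regime 1. -/
/-- Regime-1 finite-precision secure GDoF region. -/
def Dfp1 (α β : ℝ) : Set (ℝ × ℝ) :=
  {p | 0 ≤ p.1 ∧ 0 ≤ p.2 ∧ p.2 ≤ 1 ∧ p.1 + β * p.2 ≤ α}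

/-- Regime-1 perfect-CSIT secure GDoF region. -/
def Dp1 (α : ℝ) : Set (ℝ × ℝ) :=
  {p | 0 ≤ p.1 ∧ p.1 ≤ α ∧ 0 ≤ p.2 ∧ p.2 ≤ 1 ∧ p.1 + p.2 ≤ α}

/-- Regime-2 finite-precision secure GDoF region. -/
def Dfp2 (α β : ℝ) : Set (ℝ × ℝ) :=
  {p | 0 ≤ p.1 ∧ 0 ≤ p.2 ∧ p.1 / α + p.2 / (1 + α - β) ≤ 1}

/-- Regime-2 perfect-CSIT secure GDoF region. -/
def Dp2 (α β : ℝ) : Set (ℝ × ℝ) :=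
  {p | 0 ≤ p.1 ∧ p.1 ≤ α ∧ 0 ≤ p.2 ∧ p.2 ≤ 1 + α - β ∧ p.1 + p.2 ≤ α}

/-- in Regime 1, the maximal weighted sum GDoF under finite precision
CSIT is at least half of that under perfect CSIT. -/
theorem halfLoss_regime1 (α β : ℝ) (hβ : 1 < β) (hβα : β < α)
    (w₁ w₂ : ℝ) (hw₁ : 0 ≤ w₁) (hw₂ : 0 ≤ w₂) :
    sSup ((fun p : ℝ × ℝ => w₁ * p.1 + w₂ * p.2) '' Dp1 α) ≤
      2 * sSup ((fun p : ℝ × ℝ => w₁ * p.1 + w₂ * p.2) '' Dfp1 α β) := by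
  have bdd : BddAbove ((fun p : ℝ × ℝ => w₁ * p.1 + w₂ * p.2) '' Dfp1 α β) := by
    refine ⟨w₁ * α + w₂ * 1, ?_⟩
    rintro _ ⟨⟨x, y⟩, ⟨-, hy, hy1, hxy⟩, rfl⟩
    dsimp only at *
    have hx : x ≤ α := by nlinarith
    gcongr
  refine csSup_le (Set.Nonempty.image _ ⟨(0, 0), ?_⟩) ?_
  · refine ⟨le_rfl, ?_, le_rfl, zero_le_one, ?_⟩ <;> dsimp only <;> linarith
  rintro _ ⟨⟨x, y⟩, ⟨hx, -, hy, hy1, hxy⟩, rfl⟩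
  dsimp only at *
  have half_mem : (x / 2, y / 2) ∈ Dfp1 α β := by
    refine ⟨?_, ?_, ?_, ?_⟩ <;> dsimp only
    · linarith
    · linarith
    · linarith
    · nlinarith
  have key := le_csSup bdd (Set.mem_image_of_mem _ half_mem)
  dsimp only at key
  linarith
end

section
/- Let α, β be real numbers with β > 1 and β − 1 < α ≤ β, and let w₁, w₂ ≥ 0. Then sup{w₁·d₁ + w₂·d₂ : (d₁,d₂) ∈ D_p2(α,β)} ≤ 2 · sup{w₁·d₁ + w₂·d₂ : (d₁,d₂) ∈ D_fp2(α,β)}; that is, the maximal weighted sum GDoF achievable under finite precision CSIT is at least half the maximal weighted sum GDoF achievable under perfect CSIT in Regime 2. -/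
/-- Halving a perfect-CSIT point lands in the finite-precision region. -/
theorem half_mem_Dfp2_of_mem_Dp2 {α β : ℝ} (hα : 0 < α) (hγ : 0 < 1 + α - β) {p : ℝ × ℝ}
    (hp : p ∈ Dp2 α β) : (p.1 / 2, p.2 / 2) ∈ Dfp2 α β := by
  obtain ⟨h₁, h₁', h₂, h₂', -⟩ := hp
  refine ⟨by positivity, by positivity, ?_⟩
  have e₁ : p.1 / α ≤ 1 := (div_le_one hα).2 h₁'
  have e₂ : p.2 / (1 + α - β) ≤ 1 := (div_le_one hγ).2 h₂'
  simp only [div_right_comm _ (2 : ℝ)]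
  linarith

/-- Nonnegatively weighted sums are bounded above on the finite-precision region. -/
theorem bddAbove_weightedSum_Dfp2 {α β w₁ w₂ : ℝ} (hα : 0 < α) (hγ : 0 < 1 + α - β)
    (hw₁ : 0 ≤ w₁) (hw₂ : 0 ≤ w₂) :
    BddAbove ((fun p : ℝ × ℝ => w₁ * p.1 + w₂ * p.2) '' Dfp2 α β) := by
  refine ⟨w₁ * α + w₂ * (1 + α - β), ?_⟩
  rintro _ ⟨p, ⟨h₁, h₂, h⟩, rfl⟩
  have e₁ : 0 ≤ p.1 / α := by positivity
  have e₂ : 0 ≤ p.2 / (1 + α - β) := by positivity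
  have b₁ : p.1 ≤ α := (div_le_one hα).1 (by linarith)
  have b₂ : p.2 ≤ 1 + α - β := (div_le_one hγ).1 (by linarith)
  dsimp only
  gcongr

/-- in Regime 2, the maximal weighted sum GDoF under finite precision
CSIT is at least half of that under perfect CSIT. -/
theorem halfLoss_regime2 (α β : ℝ) (hβ : 1 < β) (hαl : β - 1 < α) (hαu : α ≤ β)
    (w₁ w₂ : ℝ) (hw₁ : 0 ≤ w₁) (hw₂ : 0 ≤ w₂) :
    sSup ((fun p : ℝ × ℝ => w₁ * p.1 + w₂ * p.2) '' Dp2 α β) ≤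
      2 * sSup ((fun p : ℝ × ℝ => w₁ * p.1 + w₂ * p.2) '' Dfp2 α β) := by
  have hα : 0 < α := by linarith
  have hγ : 0 < 1 + α - β := by linarith
  refine csSup_le (Set.Nonempty.image _ ⟨(0, 0), le_rfl, hα.le, le_rfl, hγ.le, by simpa using hα.le⟩)
    ?_
  rintro _ ⟨p, hp, rfl⟩
  have h := le_csSup (bddAbove_weightedSum_Dfp2 hα hγ hw₁ hw₂)
    (Set.mem_image_of_mem _ (half_mem_Dfp2_of_mem_Dp2 hα hγ hp))
  dsimp only at h ⊢
  linarith
end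

section
/- For every real α ≥ 2 (with β = α, so that 1+α−β = 1): sup{d₁ + (α−1)·d₂ : (d₁,d₂) ∈ D_fp2(α,α)} = α and sup{d₁ + (α−1)·d₂ : (d₁,d₂) ∈ D_p2(α,α)} = 2(α−1). Consequently the ratio of these two suprema equals α/(2(α−1)) and tends to 1/2 as α → ∞, so the factor-1/2 bound comparing finite-precision and perfect-CSIT weighted sum GDoF is asymptotically tight. -/
theorem isGreatest_weighted_sum_Dfp2 {α : ℝ} (hα : 0 < α) :
    IsGreatest ((fun p : ℝ × ℝ => p.1 + (α - 1) * p.2) '' Dfp2 α α) α := by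
  refine ⟨⟨(α, 0), ⟨hα.le, le_rfl, by simp [hα.ne']⟩, by simp⟩, ?_⟩
  rintro _ ⟨⟨x, y⟩, ⟨-, hy, h⟩, rfl⟩
  simp only [add_sub_cancel_right, div_one] at hy h ⊢
  have hx : x ≤ (1 - y) * α := (div_le_iff₀ hα).1 (by linarith)
  linarith

theorem isGreatest_weighted_sum_Dp2 {α : ℝ} (hα : 2 ≤ α) :
    IsGreatest ((fun p : ℝ × ℝ => p.1 + (α - 1) * p.2) '' Dp2 α α) (2 * (α - 1)) := by
  refine ⟨⟨(α - 1, 1), ?_, by ring⟩, ?_⟩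
  · refine ⟨?_, ?_, ?_, ?_, ?_⟩ <;> dsimp only <;> linarith
  rintro _ ⟨⟨x, y⟩, ⟨-, -, -, hy, h⟩, rfl⟩
  simp only [add_sub_cancel_right] at hy h ⊢
  linarith [mul_le_mul_of_nonneg_left hy (sub_nonneg.2 hα)]

theorem tendsto_div_two_mul_sub_one :
    Filter.Tendsto (fun α : ℝ => α / (2 * (α - 1))) Filter.atTop (nhds (1 / 2)) := by
  have hinv : Filter.Tendsto (fun α : ℝ => (α - 1)⁻¹) Filter.atTop (nhds 0) :=
    tendsto_inv_atTop_zero.comp (Filter.tendsto_atTop_add_const_right _ (-1) Filter.tendsto_id)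
  have hlim := (hinv.const_add 1).div_const 2
  rw [add_zero] at hlim
  refine hlim.congr' ?_
  filter_upwards [Filter.eventually_gt_atTop 1] with α hα
  have hne : α - 1 ≠ 0 := (sub_pos.2 hα).ne'
  field_simp
  ring

/-- with `β = α`, the weighted sum GDoF with weights `(1, α−1)` equals
`α` under finite precision CSIT and `2(α−1)` under perfect CSIT, so the ratio is
`α/(2(α−1))`, which tends to `1/2` as `α → ∞`: the factor-1/2 bound is asymptotically
tight. -/
theorem half_bound_asymptotically_tight :
    (∀ α : ℝ, 2 ≤ α →
      sSup ((fun p : ℝ × ℝ => p.1 + (α - 1) * p.2) '' Dfp2 α α) = α ∧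
      sSup ((fun p : ℝ × ℝ => p.1 + (α - 1) * p.2) '' Dp2 α α) = 2 * (α - 1)) ∧
    (∀ α : ℝ, 2 ≤ α →
      sSup ((fun p : ℝ × ℝ => p.1 + (α - 1) * p.2) '' Dfp2 α α) /
          sSup ((fun p : ℝ × ℝ => p.1 + (α - 1) * p.2) '' Dp2 α α) =
        α / (2 * (α - 1))) ∧
    Filter.Tendsto (fun α : ℝ => α / (2 * (α - 1))) Filter.atTop
      (nhds (1 / 2)) := by
  have hsup : ∀ α : ℝ, 2 ≤ α →
      sSup ((fun p : ℝ × ℝ => p.1 + (α - 1) * p.2) '' Dfp2 α α) = α ∧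
      sSup ((fun p : ℝ × ℝ => p.1 + (α - 1) * p.2) '' Dp2 α α) = 2 * (α - 1) := fun α hα =>
    ⟨(isGreatest_weighted_sum_Dfp2 (by linarith)).csSup_eq,
      (isGreatest_weighted_sum_Dp2 hα).csSup_eq⟩
  refine ⟨hsup, fun α hα => ?_, tendsto_div_two_mul_sub_one⟩
  rw [(hsup α hα).1, (hsup α hα).2]
end
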